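/- There is an absolute constant C > 0 with the following property. Let X be a sub-Gaussian random vector in ℝ^d with distribution μ whose function A(h) = |h|²/2 − K(h), K(h) = log E exp(⟨h,X⟩), satisfies A(h) ≥ 0 for all h; let X̄(h) = X(h) − ∇K(h), where X(h) has law Q_h μ. Then for every q ≥ 1, every h ∈ ℝ^d, and every unit vector θ ∈ ℝ^d: ( E |⟨θ, X̄(h)⟩|^q )^{2/q} ≤ C (q + A(h)). -/

import Mathlib

open MeasureTheory ProbabilityTheory Real Filter
open scoped ENNReal RealInnerProductSpace Topology

/-- A probability distribution on `ℝ^d` is sub-Gaussian if `E exp(c|X|²) < ∞` for some `c > 0`. -/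
def IsSubGaussian {d : ℕ} (μ : Measure (EuclideanSpace ℝ (Fin d))) : Prop :=
  ∃ c > 0, Integrable (fun x => Real.exp (c * ‖x‖ ^ 2)) μ

/-- The log-Laplace transform `K(t) = log ∫ e^{⟨t,x⟩} dμ(x)`. -/
noncomputable def Kfun {d : ℕ} (μ : Measure (EuclideanSpace ℝ (Fin d)))
    (t : EuclideanSpace ℝ (Fin d)) : ℝ :=
  Real.log (∫ x, Real.exp ⟪t, x⟫ ∂μ)

/-- The function `A(t) = |t|²/2 - K(t)`. -/
noncomputable def Afun {d : ℕ} (μ : Measure (EuclideanSpace ℝ (Fin d)))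
    (t : EuclideanSpace ℝ (Fin d)) : ℝ :=
  ‖t‖ ^ 2 / 2 - Kfun μ t

/-- The Esscher transform `Q_h μ`, with density `e^{⟨h,x⟩}/L(h)` with respect to `μ`. -/
noncomputable def esscher {d : ℕ} (μ : Measure (EuclideanSpace ℝ (Fin d)))
    (h : EuclideanSpace ℝ (Fin d)) : Measure (EuclideanSpace ℝ (Fin d)) :=
  μ.withDensity fun x => ENNReal.ofReal (Real.exp ⟪h, x⟫ / ∫ y, Real.exp ⟪h, y⟫ ∂μ)

section Moments

variable {Ω : Type*} [MeasurableSpace Ω]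

/-- Pointwise form of the comparison of `q`-th moments with exponential moments. -/
lemma div_rpow_le_one_add_exp {q Q w : ℝ} (hq : 1 ≤ q) (hqQ : q ≤ Q) (hw : 0 ≤ w) :
    (w / (√Q * exp 3)) ^ q ≤ 1 + exp (√Q * w - 3 * Q) := by
  have hQ : 0 < Q := by linarith
  have hr : 0 < √Q := Real.sqrt_pos.2 hQ
  have hrr : √Q * √Q = Q := Real.mul_self_sqrt hQ.le
  rcases le_or_gt (w / (√Q * exp 3)) 1 with hle | hlt
  · have h1 : (w / (√Q * exp 3)) ^ q ≤ 1 :=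
      Real.rpow_le_one (by positivity) hle (by linarith)
    linarith [exp_pos (√Q * w - 3 * Q)]
  · have h0 : 0 < w / (√Q * exp 3) := by linarith
    have hwr : 0 < w / √Q := by
      have : w / √Q = w / (√Q * exp 3) * exp 3 := by field_simp
      rw [this]; positivity
    have hlog : log (w / (√Q * exp 3)) ≤ w / √Q - 3 := by
      rw [← div_div, Real.log_div hwr.ne' (exp_pos 3).ne', Real.log_exp]
      linarith [Real.log_le_sub_one_of_pos hwr]
    calc (w / (√Q * exp 3)) ^ q ≤ (w / (√Q * exp 3)) ^ Q :=
          Real.rpow_le_rpow_of_exponent_le hlt.le hqQ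
      _ = exp (log (w / (√Q * exp 3)) * Q) := Real.rpow_def_of_pos h0 _
      _ ≤ exp ((w / √Q - 3) * Q) := by gcongr
      _ = exp (√Q * w - 3 * Q) := by
          congr 1
          have : w / √Q * Q = √Q * w := by
            nth_rewrite 2 [← hrr]
            field_simp
          linarith
      _ ≤ 1 + exp (√Q * w - 3 * Q) := by linarith

/-- A random variable whose moment generating function is at most `exp (s² + 2a)` satisfies
`(E |Y|^q)^{2/q} ≤ 9 e⁶ (q + a)`. -/
lemma integral_abs_rpow_le_of_integral_exp_le {ν : Measure Ω} [IsProbabilityMeasure ν]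
    {Y : Ω → ℝ} {a q : ℝ} (ha : 0 ≤ a) (hq : 1 ≤ q)
    (hY : ∀ s : ℝ, Integrable (fun x => exp (s * Y x)) ν)
    (hexp : ∀ s : ℝ, ∫ x, exp (s * Y x) ∂ν ≤ exp (s ^ 2 + 2 * a)) :
    (∫ x, |Y x| ^ q ∂ν) ^ (2 / q) ≤ 9 * exp 6 * (q + a) := by
  set Q := q + a with hQdef
  have hQ : 0 < Q := by linarith
  set r := √Q with hr
  have hr0 : 0 < r := Real.sqrt_pos.2 hQ
  have hrr : r ^ 2 = Q := Real.sq_sqrt hQ.le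
  set B := r * exp 3 with hB
  have hB0 : 0 < B := by positivity
  have hpt : ∀ x, |Y x| ^ q ≤
      B ^ q * (1 + exp (-3 * Q) * (exp (r * Y x) + exp (-r * Y x))) := by
    intro x
    have h1 := div_rpow_le_one_add_exp hq (show q ≤ Q by linarith) (abs_nonneg (Y x))
    rw [Real.div_rpow (abs_nonneg _) hB0.le, div_le_iff₀ (by positivity)] at h1
    have h2 : exp (r * |Y x| - 3 * Q) ≤
        exp (-3 * Q) * (exp (r * Y x) + exp (-r * Y x)) := by
      rw [show r * |Y x| - 3 * Q = -3 * Q + r * |Y x| by ring, Real.exp_add]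
      gcongr
      rcases abs_cases (Y x) with ⟨h, _⟩ | ⟨h, _⟩ <;> rw [h]
      · linarith [exp_pos (-r * Y x)]
      · rw [show r * -Y x = -r * Y x by ring]
        linarith [exp_pos (r * Y x)]
    calc |Y x| ^ q ≤ (1 + exp (r * |Y x| - 3 * Q)) * B ^ q := h1
      _ ≤ (1 + exp (-3 * Q) * (exp (r * Y x) + exp (-r * Y x))) * B ^ q := by gcongr
      _ = _ := mul_comm _ _
  have hI : Integrable (fun x => exp (r * Y x) + exp (-r * Y x)) ν := (hY r).add (hY (-r))
  have hmom : ∫ x, |Y x| ^ q ∂ν ≤ B ^ q * 3 := by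
    calc ∫ x, |Y x| ^ q ∂ν
        ≤ ∫ x, B ^ q * (1 + exp (-3 * Q) * (exp (r * Y x) + exp (-r * Y x))) ∂ν := by
          refine integral_mono_of_nonneg (ae_of_all _ fun x => by positivity) ?_
            (ae_of_all _ hpt)
          exact ((integrable_const 1).add (hI.const_mul _)).const_mul _
      _ = B ^ q * (1 + exp (-3 * Q) *
            (∫ x, exp (r * Y x) ∂ν + ∫ x, exp (-r * Y x) ∂ν)) := by
          rw [integral_const_mul, integral_add (integrable_const 1) (hI.const_mul _),
            integral_const_mul, integral_add (hY r) (hY (-r))]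
          simp
      _ ≤ B ^ q * (1 + exp (-3 * Q) * (exp (3 * Q) + exp (3 * Q))) := by
          have h3 : r ^ 2 + 2 * a ≤ 3 * Q := by linarith
          gcongr
          · exact (hexp r).trans (by gcongr)
          · exact (hexp (-r)).trans (by rw [neg_sq]; gcongr)
      _ = B ^ q * 3 := by
          have : exp (-3 * Q) * exp (3 * Q) = 1 := by rw [← Real.exp_add]; simp
          linear_combination 2 * B ^ q * this
  have h0 : 0 ≤ ∫ x, |Y x| ^ q ∂ν := integral_nonneg fun x => by positivity
  calc (∫ x, |Y x| ^ q ∂ν) ^ (2 / q) ≤ (B ^ q * 3) ^ (2 / q) := by gcongr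
    _ ≤ (B ^ q * 3 ^ q) ^ (2 / q) := by
        gcongr
        simpa using Real.rpow_le_rpow_of_exponent_le (show (1 : ℝ) ≤ 3 by norm_num) hq
    _ = (B * 3) ^ (2 : ℝ) := by
        rw [← Real.mul_rpow hB0.le (by norm_num), ← Real.rpow_mul (by positivity)]
        congr 1
        field_simp
    _ = 9 * exp 6 * Q := by
        rw [Real.rpow_two, ← hrr, hB, show (6 : ℝ) = 3 + 3 by norm_num, Real.exp_add]
        ring

end Moments

section Laplace

variable {d : ℕ} {μ : Measure (EuclideanSpace ℝ (Fin d))}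

lemma IsSubGaussian.integrable_exp_mul_norm (hμ : IsSubGaussian μ) (a : ℝ) :
    Integrable (fun x => exp (a * ‖x‖)) μ := by
  obtain ⟨c, hc, hY⟩ := hμ
  refine (hY.const_mul (exp (a ^ 2 / (4 * c)))).mono' (by fun_prop) (ae_of_all _ fun x => ?_)
  rw [Real.norm_eq_abs, Real.abs_exp, ← Real.exp_add, Real.exp_le_exp]
  have : a ^ 2 / (4 * c) + c * ‖x‖ ^ 2 - a * ‖x‖ = (a - 2 * c * ‖x‖) ^ 2 / (4 * c) := by
    field_simp
    ring
  have h2 : 0 ≤ (a - 2 * c * ‖x‖) ^ 2 / (4 * c) := by positivity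
  linarith

lemma IsSubGaussian.integrable_exp_inner (hμ : IsSubGaussian μ)
    (t : EuclideanSpace ℝ (Fin d)) : Integrable (fun x => exp ⟪t, x⟫) μ := by
  refine (hμ.integrable_exp_mul_norm ‖t‖).mono' (by fun_prop) (ae_of_all _ fun x => ?_)
  rw [Real.norm_eq_abs, Real.abs_exp, Real.exp_le_exp]
  exact real_inner_le_norm t x

lemma norm_exp_inner_smul_innerSL_le {h t : EuclideanSpace ℝ (Fin d)}
    (ht : t ∈ Metric.ball h 1) (x : EuclideanSpace ℝ (Fin d)) :
    ‖exp ⟪t, x⟫ • innerSL ℝ x‖ ≤ exp ((‖h‖ + 2) * ‖x‖) := by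
  rw [norm_smul, Real.norm_eq_abs, Real.abs_exp, innerSL_apply_norm]
  have h1 : ‖t‖ ≤ ‖h‖ + 1 := by
    have := norm_le_norm_add_norm_sub' t h
    rw [Metric.mem_ball, dist_eq_norm] at ht
    linarith
  have h2 : ⟪t, x⟫ ≤ (‖h‖ + 1) * ‖x‖ := (real_inner_le_norm t x).trans (by gcongr)
  calc exp ⟪t, x⟫ * ‖x‖ ≤ exp ((‖h‖ + 1) * ‖x‖) * exp ‖x‖ := by
        gcongr
        linarith [Real.add_one_le_exp ‖x‖]
    _ = exp ((‖h‖ + 2) * ‖x‖) := by rw [← Real.exp_add]; ring_nf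

lemma IsSubGaussian.integrable_exp_inner_smul_innerSL (hμ : IsSubGaussian μ)
    (h : EuclideanSpace ℝ (Fin d)) :
    Integrable (fun x => exp ⟪h, x⟫ • innerSL ℝ x) μ :=
  (hμ.integrable_exp_mul_norm (‖h‖ + 2)).mono'
    (by fun_prop) (ae_of_all _ fun x =>
      norm_exp_inner_smul_innerSL_le (Metric.mem_ball_self one_pos) x)

lemma IsSubGaussian.hasFDerivAt_integral_exp_inner (hμ : IsSubGaussian μ)
    (h : EuclideanSpace ℝ (Fin d)) :
    HasFDerivAt (fun t => ∫ x, exp ⟪t, x⟫ ∂μ) (∫ x, exp ⟪h, x⟫ • innerSL ℝ x ∂μ) h := by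
  refine hasFDerivAt_integral_of_dominated_of_fderiv_le
    (F' := fun t x => exp ⟪t, x⟫ • innerSL ℝ x)
    (bound := fun x => exp ((‖h‖ + 2) * ‖x‖)) (Metric.ball_mem_nhds h one_pos)
    (Eventually.of_forall fun t => (hμ.integrable_exp_inner t).1)
    (hμ.integrable_exp_inner h) (hμ.integrable_exp_inner_smul_innerSL h).1
    (ae_of_all _ fun x t ht => norm_exp_inner_smul_innerSL_le ht x)
    (hμ.integrable_exp_mul_norm _) (ae_of_all _ fun x t _ => ?_)
  have h1 : HasFDerivAt (fun s : EuclideanSpace ℝ (Fin d) => ⟪s, x⟫) (innerSL ℝ x) t := by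
    have : (fun s : EuclideanSpace ℝ (Fin d) => ⟪s, x⟫) = innerSL ℝ x := by
      ext s
      simp [real_inner_comm]
    rw [this]
    exact (innerSL ℝ x).hasFDerivAt
  exact h1.exp

lemma esscher_eq_tilted (μ : Measure (EuclideanSpace ℝ (Fin d)))
    (h : EuclideanSpace ℝ (Fin d)) : esscher μ h = μ.tilted fun x => ⟪h, x⟫ := rfl

lemma IsSubGaussian.integrable_inner_esscher (hμ : IsSubGaussian μ)
    (h θ : EuclideanSpace ℝ (Fin d)) :
    Integrable (fun x => ⟪θ, x⟫) (esscher μ h) := by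
  rw [esscher_eq_tilted, integrable_tilted_iff (hμ.integrable_exp_inner h)]
  refine ((hμ.integrable_exp_inner_smul_innerSL h).apply_continuousLinearMap θ).congr
    (ae_of_all _ fun x => ?_)
  simp [real_inner_comm]

/-- The gradient of the log-Laplace transform at `h` is the mean of the Esscher transform. -/
lemma IsSubGaussian.inner_gradient_Kfun [IsProbabilityMeasure μ] (hμ : IsSubGaussian μ)
    (h θ : EuclideanSpace ℝ (Fin d)) :
    ⟪θ, gradient (Kfun μ) h⟫ = ∫ x, ⟪θ, x⟫ ∂(esscher μ h) := by
  have hpos : 0 < ∫ x, exp ⟪h, x⟫ ∂μ := integral_exp_pos (hμ.integrable_exp_inner h)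
  have hK : HasFDerivAt (Kfun μ) _ h := (hμ.hasFDerivAt_integral_exp_inner h).log hpos.ne'
  rw [real_inner_comm, inner_gradient_left, hK.fderiv, smul_apply,
    ContinuousLinearMap.integral_apply (hμ.integrable_exp_inner_smul_innerSL h),
    esscher_eq_tilted, integral_tilted, smul_eq_mul, ← integral_const_mul]
  refine integral_congr_ae (ae_of_all _ fun x => ?_)
  simp only [smul_apply, innerSL_apply_apply, smul_eq_mul,
    real_inner_comm x θ]
  ring

lemma exp_inner_mul_exp (h θ g x : EuclideanSpace ℝ (Fin d)) (s : ℝ) :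
    exp ⟪h, x⟫ * exp (s * ⟪θ, x - g⟫) = exp (-(s * ⟪θ, g⟫)) * exp ⟪h + s • θ, x⟫ := by
  rw [← Real.exp_add, ← Real.exp_add, inner_sub_right, inner_add_left, real_inner_smul_left]
  ring_nf

lemma IsSubGaussian.integrable_exp_mul_inner_sub_esscher (hμ : IsSubGaussian μ)
    (h θ g : EuclideanSpace ℝ (Fin d)) (s : ℝ) :
    Integrable (fun x => exp (s * ⟪θ, x - g⟫)) (esscher μ h) := by
  rw [esscher_eq_tilted, integrable_tilted_iff (hμ.integrable_exp_inner h)]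
  simp_rw [smul_eq_mul, exp_inner_mul_exp]
  exact (hμ.integrable_exp_inner _).const_mul _

/-- The Laplace transform of the recentred Esscher transform. -/
lemma IsSubGaussian.integral_exp_mul_inner_sub_esscher [IsProbabilityMeasure μ]
    (hμ : IsSubGaussian μ) (h θ g : EuclideanSpace ℝ (Fin d)) (s : ℝ) :
    ∫ x, exp (s * ⟪θ, x - g⟫) ∂(esscher μ h) =
      exp (Kfun μ (h + s • θ) - Kfun μ h - s * ⟪θ, g⟫) := by
  have hpos : ∀ t, 0 < ∫ x, exp ⟪t, x⟫ ∂μ := fun t =>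
    integral_exp_pos (hμ.integrable_exp_inner t)
  rw [esscher_eq_tilted, integral_tilted]
  simp_rw [smul_eq_mul, div_mul_eq_mul_div, exp_inner_mul_exp]
  rw [integral_div, integral_const_mul, Real.exp_sub, Real.exp_sub, Kfun, Kfun,
    Real.exp_log (hpos _), Real.exp_log (hpos _), Real.exp_neg]
  ring

lemma IsSubGaussian.integral_exp_esscher_le [IsProbabilityMeasure μ] (hμ : IsSubGaussian μ)
    (hA : ∀ h, 0 ≤ Afun μ h) (h : EuclideanSpace ℝ (Fin d)) {θ : EuclideanSpace ℝ (Fin d)}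
    (hθ : ‖θ‖ = 1) (s : ℝ) :
    ∫ x, exp (s * ⟪θ, x - gradient (Kfun μ) h⟫) ∂(esscher μ h) ≤
      exp (s ^ 2 + 2 * Afun μ h) := by
  set g := gradient (Kfun μ) h with hg
  have : IsProbabilityMeasure (esscher μ h) :=
    isProbabilityMeasure_tilted (hμ.integrable_exp_inner h)
  have hnorm : ∀ u : ℝ, ‖h + u • θ‖ ^ 2 = ‖h‖ ^ 2 + 2 * u * ⟪θ, h⟫ + u ^ 2 := by
    intro u
    rw [norm_add_sq_real, real_inner_smul_right, norm_smul, hθ, real_inner_comm,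
      Real.norm_eq_abs, mul_one, sq_abs]
    ring
  set a := ⟪θ, h⟫ - ⟪θ, g⟫ with ha
  have hφ : ∀ u : ℝ, Kfun μ (h + u • θ) - Kfun μ h - u * ⟪θ, g⟫ ≤
      u * a + u ^ 2 / 2 + Afun μ h := by
    intro u
    have h1 := hA (h + u • θ)
    have h2 := hnorm u
    simp only [Afun] at h1 ⊢
    rw [h2] at h1
    rw [ha]
    linarith
  have hmean : ∀ u : ℝ, 0 ≤ Kfun μ (h + u • θ) - Kfun μ h - u * ⟪θ, g⟫ := by
    intro u
    have hlin : Integrable (fun x => ⟪θ, x - g⟫) (esscher μ h) := by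
      simp_rw [inner_sub_right]
      exact (hμ.integrable_inner_esscher h θ).sub (integrable_const _)
    have hzero : ∫ x, ⟪θ, x - g⟫ ∂(esscher μ h) = 0 := by
      simp_rw [inner_sub_right]
      rw [integral_sub (hμ.integrable_inner_esscher h θ) (integrable_const _),
        ← hμ.inner_gradient_Kfun h θ]
      simp [hg]
    have h1 : ∫ x, (u * ⟪θ, x - g⟫ + 1) ∂(esscher μ h) ≤
        ∫ x, exp (u * ⟪θ, x - g⟫) ∂(esscher μ h) :=
      integral_mono ((hlin.const_mul u).add (integrable_const 1))
        (hμ.integrable_exp_mul_inner_sub_esscher h θ g u) fun x => Real.add_one_le_exp _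
    rw [integral_add (hlin.const_mul u) (integrable_const 1), integral_const_mul, hzero,
      hμ.integral_exp_mul_inner_sub_esscher] at h1
    simpa using h1
  rw [hμ.integral_exp_mul_inner_sub_esscher, Real.exp_le_exp]
  have h1 := (hmean (-a)).trans (hφ (-a))
  have h2 := hφ s
  nlinarith [sq_nonneg (s - a)]

end Laplace

theorem stmt11 :
    ∃ C : ℝ, 0 < C ∧
      ∀ (d : ℕ) (μ : Measure (EuclideanSpace ℝ (Fin d))),
        IsProbabilityMeasure μ → IsSubGaussian μ → (∀ h, 0 ≤ Afun μ h) →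
        ∀ q : ℝ, 1 ≤ q → ∀ h θ : EuclideanSpace ℝ (Fin d), ‖θ‖ = 1 →
          (∫ x, |⟪θ, x - gradient (Kfun μ) h⟫| ^ q ∂(esscher μ h)) ^ (2 / q)
            ≤ C * (q + Afun μ h) := by
  refine ⟨9 * exp 6, by positivity, fun d μ _ hμ hA q hq h θ hθ => ?_⟩
  have : IsProbabilityMeasure (esscher μ h) :=
    isProbabilityMeasure_tilted (hμ.integrable_exp_inner h)
  exact integral_abs_rpow_le_of_integral_exp_le (hA h) hq
    (hμ.integrable_exp_mul_inner_sub_esscher h θ _) (hμ.integral_exp_esscher_le hA h hθ)
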